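/- Let H be an elementary abelian 2-hypergroup and G ⊆ H. Then G is a closed subset of H if and only if there exist r ∈ Thick(H) and F ⊆ H such that O^ϑ(G) = ⟨r⟩, F^γ is a subgroup of the elementary abelian 2-group O_ϑ(H)^γ, G = ⟨r⟩·F, ⟨r⟩ ∩ F = {e}, and O_ϑ(G) = F. -/

import Mathlib

namespace HyperPaper

/-- A hypergroup: hypermultiplication `hmul`, inversion `star`, identity `e`,
satisfying (H1) associativity, (H2) unique two-sided identity, (H3) exchange conditions. -/
structure Hypergroup (H : Type*) where
  hmul : H → H → Set H
  star : H → H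
  e : H
  idl : ∀ p, hmul e p = {p}
  idr : ∀ p, hmul p e = {p}
  e_unique : ∀ e' : H, (∀ p, hmul e' p = {p} ∧ hmul p e' = {p}) → e' = e
  assoc : ∀ p q r : H, (⋃ x ∈ hmul p q, hmul x r) = ⋃ x ∈ hmul q r, hmul p x
  h3l : ∀ p q r : H, p ∈ hmul q r ↔ q ∈ hmul p (star r)
  h3r : ∀ p q r : H, p ∈ hmul q r ↔ r ∈ hmul (star q) p

variable {H : Type*}

namespace Hypergroup

/-- Product of two subsets: FG = {a : ∃ b ∈ F, c ∈ G, a ∈ bc}. -/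
def smul (hg : Hypergroup H) (F G : Set H) : Set H :=
  {a | ∃ b ∈ F, ∃ c ∈ G, a ∈ hg.hmul b c}

/-- Closed subset: nonempty and G*G ⊆ G. -/
def IsClosed (hg : Hypergroup H) (G : Set H) : Prop :=
  G.Nonempty ∧ hg.smul (hg.star '' G) G ⊆ G

/-- Thin element: p*p = {e}. -/
def IsThin (hg : Hypergroup H) (p : H) : Prop := hg.hmul (hg.star p) p = {hg.e}

/-- Thick element: not thin. -/
def IsThick (hg : Hypergroup H) (p : H) : Prop := ¬ hg.IsThin p

/-- Involution: p ≠ e and {e, p} is closed. -/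
def IsInvolution (hg : Hypergroup H) (p : H) : Prop :=
  p ≠ hg.e ∧ hg.IsClosed {hg.e, p}

/-- ⟨G⟩: smallest closed subset containing G. -/
def gen (hg : Hypergroup H) (G : Set H) : Set H := ⋂₀ {C | hg.IsClosed C ∧ G ⊆ C}

/-- O_ϑ(G): the thin elements of H lying in G. -/
def Othin (hg : Hypergroup H) (G : Set H) : Set H := {p ∈ G | hg.IsThin p}

/-- F is a strongly normal closed subset of G: p*Fp ⊆ F ⊆ G for all p ∈ G. -/
def IsStronglyNormal (hg : Hypergroup H) (F G : Set H) : Prop :=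
  hg.IsClosed F ∧ hg.IsClosed G ∧ F ⊆ G ∧
    ∀ p ∈ G, hg.smul (hg.smul {hg.star p} F) {p} ⊆ F

/-- O^ϑ(G): intersection of all strongly normal closed subsets of ⟨G⟩. -/
def Osup (hg : Hypergroup H) (G : Set H) : Set H :=
  ⋂₀ {F | hg.IsStronglyNormal F (hg.gen G)}

/-- F is a normal closed subset of G. -/
def IsNormal (hg : Hypergroup H) (F G : Set H) : Prop :=
  hg.IsClosed F ∧ hg.IsClosed G ∧ F ⊆ G ∧ ∀ p ∈ G, hg.smul F {p} = hg.smul {p} F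

/-- Product of a list of subsets (empty product is {e}). -/
def listProd (hg : Hypergroup H) : List (Set H) → Set H
  | [] => {hg.e}
  | a :: l => hg.smul a (hg.listProd l)

/-- Product r_1 r_2 ⋯ r_n of a family of elements. -/
def famProd (hg : Hypergroup H) {n : ℕ} (r : Fin n → H) : Set H :=
  hg.listProd ((List.finRange n).map fun i => ({r i} : Set H))

/-- Ĝ_i: the product of the G_j with j ≠ i. -/
def cofactor (hg : Hypergroup H) {n : ℕ} (G : Fin n → Set H) (i : Fin n) : Set H :=
  hg.listProd (((List.finRange n).filter fun j => decide (j ≠ i)).map G)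

/-- H is the direct product of the normal closed subsets G_1, …, G_n. -/
def IsDirectProduct (hg : Hypergroup H) {n : ℕ} (G : Fin n → Set H) : Prop :=
  (∀ i, hg.IsNormal (G i) Set.univ) ∧
  (∀ i, hg.smul (G i) (hg.cofactor G i) = Set.univ) ∧
  (∀ i, G i ∩ hg.cofactor G i = {hg.e})

/-- r : Fin n → H is a decomposition of x with respect to the family G. -/
def IsDecomp (hg : Hypergroup H) {n : ℕ} (G : Fin n → Set H) (x : H) (r : Fin n → H) : Prop :=
  (∀ i, r i ∈ G i) ∧ x ∈ hg.famProd r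

/-- The support of x: the elements ≠ e appearing in the decomposition of x. -/
def dsupport (hg : Hypergroup H) {n : ℕ} (G : Fin n → Set H) (x : H) : Set H :=
  {y | y ≠ hg.e ∧ ∃ r, hg.IsDecomp G x r ∧ y ∈ Set.range r}

/-- The cover of x: the product r_1r_2⋯r_n for the decomposition of x. -/
def dcover (hg : Hypergroup H) {n : ℕ} (G : Fin n → Set H) (x : H) : Set H :=
  {y | ∃ r, hg.IsDecomp G x r ∧ y ∈ hg.famProd r}

/-- x is constrained: its cover equals {x}. -/
def IsConstrained (hg : Hypergroup H) {n : ℕ} (G : Fin n → Set H) (x : H) : Prop :=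
  hg.dcover G x = {x}

/-- r_2(G): the largest 2-rank of a thin closed subset of H contained in G
(equivalently, the largest k such that G contains a thin symmetric closed subset
of 2^k elements, which corresponds to an elementary abelian 2-group of 2-rank k). -/
noncomputable def rank2 (hg : Hypergroup H) (G : Set H) : ℕ :=
  sSup {k | ∃ U : Set H, hg.IsClosed U ∧ U ⊆ G ∧ (∀ u ∈ U, hg.IsThin u) ∧
    (∀ u ∈ U, hg.star u = u) ∧ U.ncard = 2 ^ k}

/-- F is a minimal generating subset of G. -/
def IsMinGen (hg : Hypergroup H) (G F : Set H) : Prop :=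
  F ⊆ G ∧ hg.gen F = G ∧ ∀ p ∈ F, hg.gen (F \ {p}) ≠ G

/-- The dimension of G: the smallest cardinality of a minimal generating subset. -/
noncomputable def dimension (hg : Hypergroup H) (G : Set H) : ℕ :=
  sInf {k | ∃ F : Set H, hg.IsMinGen G F ∧ F.Finite ∧ F.ncard = k}

/-- [F, G] = ⟨{a : ∃ b ∈ F, c ∈ G, a ∈ b*c*bc}⟩. -/
def commSet (hg : Hypergroup H) (F G : Set H) : Set H :=
  hg.gen {a | ∃ b ∈ F, ∃ c ∈ G,
    a ∈ hg.smul (hg.smul (hg.smul {hg.star b} {hg.star c}) {b}) {c}}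

/-- derived G k = G^{(k+1)}: G^{(1)} = G, G^{(r)} = [G^{(r-1)}, G]. -/
def derived (hg : Hypergroup H) (G : Set H) : ℕ → Set H
  | 0 => G
  | k + 1 => hg.commSet (hg.derived G k) G

/-- G is nilpotent: G^{(r)} = {e} for some r. -/
def IsNilpotent (hg : Hypergroup H) (G : Set H) : Prop :=
  ∃ k : ℕ, hg.derived G k = {hg.e}

/-- G is a residually thin closed subset: there is a chain {e} = F_1, …, F_n = G of
pairwise distinct closed subsets, each strongly normal in the next. -/
def IsResiduallyThin (hg : Hypergroup H) (G : Set H) : Prop :=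
  ∃ (m : ℕ) (F : Fin (m + 1) → Set H), Function.Injective F ∧
    F 0 = {hg.e} ∧ F (Fin.last m) = G ∧
    ∀ i : Fin m, hg.IsStronglyNormal (F i.castSucc) (F i.succ)

/-- x^k as a subset: x^0 = {e}, x^{k+1} = x^k · x. -/
def spow (hg : Hypergroup H) (x : H) : ℕ → Set H
  | 0 => {hg.e}
  | k + 1 => hg.smul (hg.spow x k) {x}

/-- F is a maximal closed subset of G. -/
def IsMaximalClosed (hg : Hypergroup H) (F G : Set H) : Prop :=
  hg.IsClosed F ∧ hg.IsClosed G ∧ F ⊆ G ∧ F ≠ G ∧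
    ∀ E : Set H, hg.IsClosed E → F ⊆ E → E ⊆ G → E = F ∨ E = G

/-- The Frattini closed subset of G: the intersection (inside G) of all maximal
closed subsets of G. -/
def frattini (hg : Hypergroup H) (G : Set H) : Set H :=
  G ∩ ⋂₀ {F | hg.IsMaximalClosed F G}

/-- α is an isomorphism from the closed subset F to the closed subset G. -/
def IsIso (hg : Hypergroup H) (F G : Set H) (α : H → H) : Prop :=
  Set.BijOn α F G ∧ α hg.e = hg.e ∧
    ∀ p ∈ F, ∀ q ∈ F, α '' hg.hmul p q = hg.hmul (α p) (α q)

/-- F ≃ G: there is an isomorphism from F to G. -/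
def Isomorphic (hg : Hypergroup H) (F G : Set H) : Prop := ∃ α : H → H, hg.IsIso F G α

/-- Aut(G): the automorphism group of G, realized as the subgroup of permutations of G
that fix e and preserve the hypermultiplication. -/
def autGroup (hg : Hypergroup H) (G : Set H) : Subgroup (Equiv.Perm G) where
  carrier := {σ | (∀ x : G, (x : H) = hg.e → ((σ x : H)) = hg.e) ∧
    ∀ p q x : G, (x : H) ∈ hg.hmul p q ↔ ((σ x : H)) ∈ hg.hmul (σ p) (σ q)}
  one_mem' := by
    constructor
    · intro x hx; simpa using hx
    · intro p q x; simp
  mul_mem' := by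
    rintro σ τ ⟨he1, hm1⟩ ⟨he2, hm2⟩
    refine ⟨fun x hx => ?_, fun p q x => ?_⟩
    · simpa using he1 _ (he2 x hx)
    · simpa using (hm2 p q x).trans (hm1 (τ p) (τ q) (τ x))
  inv_mem' := by
    rintro σ ⟨he, hm⟩
    refine ⟨fun x hx => ?_, fun p q x => ?_⟩
    · have h2 : σ x = x := Subtype.ext ((he x hx).trans hx.symm)
      have h3 : σ⁻¹ x = x := by
        conv_lhs => rw [← h2]
        simp
      rw [h3]; exact hx
    · have h := hm (σ⁻¹ p) (σ⁻¹ q) (σ⁻¹ x)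
      simpa using h.symm

end Hypergroup

/-- An elementary abelian 2-hypergroup: a hypergroup that is the constrained direct
product of the closed subsets ⟨q_1⟩, …, ⟨q_n⟩ generated by involutions q_1, …, q_n. -/
structure EA2Data (H : Type*) where
  hg : Hypergroup H
  n : ℕ
  q : Fin n → H
  invol : ∀ i, hg.IsInvolution (q i)
  dp : hg.IsDirectProduct fun i => hg.gen {q i}
  constrained : ∀ x : H, hg.IsConstrained (fun i => hg.gen {q i}) x

namespace EA2Data

/-- The family ⟨q_1⟩, …, ⟨q_n⟩. -/
def fam (E : EA2Data H) : Fin E.n → Set H := fun i => E.hg.gen {E.q i}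

/-- The support of x. -/
def support (E : EA2Data H) (x : H) : Set H := E.hg.dsupport E.fam x

/-- Thick(F): externally thick elements of H lying in F. -/
def ThickIn (E : EA2Data H) (F : Set H) : Set H :=
  {x ∈ F | x = E.hg.e ∨ ∀ y ∈ E.support x, E.hg.IsThick y}

/-- Thin(F): externally thin elements of H lying in F. -/
def ThinIn (E : EA2Data H) (F : Set H) : Set H :=
  {x ∈ F | x = E.hg.e ∨ ∀ y ∈ E.support x, E.hg.IsThin y}

/-- The (unique) pair (x⁺, x⁻) with x⁺ ∈ Thick(H), x⁻ ∈ Thin(H), x⁺x⁻ = {x}. -/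
noncomputable def pm (E : EA2Data H) (x : H) : H × H :=
  @Classical.epsilon (H × H) ⟨(E.hg.e, E.hg.e)⟩ fun z =>
    z.1 ∈ E.ThickIn Set.univ ∧ z.2 ∈ E.ThinIn Set.univ ∧ E.hg.hmul z.1 z.2 = {x}

/-- x⁺. -/
noncomputable def plus (E : EA2Data H) (x : H) : H := (E.pm x).1

/-- x⁻. -/
noncomputable def minus (E : EA2Data H) (x : H) : H := (E.pm x).2

/-- s(x): the number of thick elements of H in the support of x. -/
noncomputable def sElem (E : EA2Data H) (x : H) : ℕ :=
  {y ∈ E.support x | E.hg.IsThick y}.ncard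

/-- s(G) = max {s(a) : a ∈ G}. -/
noncomputable def sSet (E : EA2Data H) (G : Set H) : ℕ :=
  sSup {k | ∃ a ∈ G, E.sElem a = k}

/-- x ⪯ y: the support of x is contained in the support of y. -/
def ple (E : EA2Data H) (x y : H) : Prop := E.support x ⊆ E.support y

/-- p♯: the number of thick elements among q_1, …, q_n. -/
noncomputable def psharp (E : EA2Data H) : ℕ := {i : Fin E.n | E.hg.IsThick (E.q i)}.ncard

end EA2Data

/-- The Gaussian binomial coefficient C(n, k)_2 with base 2, via the
q-Pascal recurrence C(n, k)_2 = C(n-1, k-1)_2 + 2^k · C(n-1, k)_2. -/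
def gaussBinom2 : ℕ → ℕ → ℕ
  | _, 0 => 1
  | 0, _ + 1 => 0
  | n + 1, k + 1 => gaussBinom2 n k + 2 ^ (k + 1) * gaussBinom2 n (k + 1)

end HyperPaper

open HyperPaper

namespace HyperPaper

variable {H : Type*}

namespace Hypergroup

variable (hg : Hypergroup H)

theorem mem_self_hmul_star (p : H) : hg.e ∈ hg.hmul p (hg.star p) :=
  (hg.h3l p hg.e p).1 (by simp [hg.idl])

theorem mem_star_hmul_self (p : H) : hg.e ∈ hg.hmul (hg.star p) p :=
  (hg.h3r p p hg.e).1 (by simp [hg.idr])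

theorem eq_star_of_e_mem {a b : H} (h : hg.e ∈ hg.hmul a b) : a = hg.star b := by
  simpa [hg.idl] using (hg.h3l _ _ _).1 h

theorem star_star (p : H) : hg.star (hg.star p) = p :=
  (hg.eq_star_of_e_mem (hg.mem_self_hmul_star p)).symm

theorem star_e : hg.star hg.e = hg.e :=
  (hg.eq_star_of_e_mem (by simp [hg.idl])).symm

theorem hmul_nonempty (p q : H) : (hg.hmul p q).Nonempty := by
  have h : p ∈ ⋃ x ∈ hg.hmul q (hg.star q), hg.hmul p x :=
    Set.mem_biUnion (hg.mem_self_hmul_star q) (by simp [hg.idr])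
  rw [← hg.assoc] at h
  obtain ⟨x, hx, -⟩ := Set.mem_iUnion₂.1 h
  exact ⟨x, hx⟩

theorem smul_mono {A B C D : Set H} (h : A ⊆ B) (h' : C ⊆ D) : hg.smul A C ⊆ hg.smul B D :=
  fun _ ⟨b, hb, c, hc, ha⟩ => ⟨b, h hb, c, h' hc, ha⟩

theorem smul_singleton (p q : H) : hg.smul {p} {q} = hg.hmul p q := by
  ext; simp [smul]

theorem smul_assoc (A B C : Set H) : hg.smul (hg.smul A B) C = hg.smul A (hg.smul B C) := by
  ext z
  constructor
  · rintro ⟨x, ⟨a, ha, b, hb, hx⟩, c, hc, hz⟩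
    have h : z ∈ ⋃ x ∈ hg.hmul a b, hg.hmul x c := Set.mem_biUnion hx hz
    rw [hg.assoc] at h
    obtain ⟨y, hy, hz⟩ := Set.mem_iUnion₂.1 h
    exact ⟨a, ha, y, ⟨b, hb, c, hc, hy⟩, hz⟩
  · rintro ⟨a, ha, x, ⟨b, hb, c, hc, hx⟩, hz⟩
    have h : z ∈ ⋃ x ∈ hg.hmul b c, hg.hmul a x := Set.mem_biUnion hx hz
    rw [← hg.assoc] at h
    obtain ⟨y, hy, hz⟩ := Set.mem_iUnion₂.1 h
    exact ⟨y, ⟨a, ha, b, hb, hy⟩, c, hc, hz⟩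

/-- The monoid of subsets of a hypergroup under the complex product. -/
@[reducible] def setMonoid : Monoid (Set H) where
  mul := hg.smul
  one := {hg.e}
  mul_assoc := hg.smul_assoc
  one_mul A := by
    ext x
    change (∃ b ∈ ({hg.e} : Set H), ∃ c ∈ A, x ∈ hg.hmul b c) ↔ x ∈ A
    simp [hg.idl]
  mul_one A := by
    ext x
    change (∃ b ∈ A, ∃ c ∈ ({hg.e} : Set H), x ∈ hg.hmul b c) ↔ x ∈ A
    simp [hg.idr]

theorem listProd_eq_prod (l : List (Set H)) :
    hg.listProd l = (letI := hg.setMonoid; l.prod) := by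
  induction l with
  | nil => rfl
  | cons a l ih => simp only [listProd, List.prod_cons, ih]; rfl

theorem e_mem_listProd {l : List (Set H)} (h : ∀ A ∈ l, hg.e ∈ A) : hg.e ∈ hg.listProd l := by
  induction l with
  | nil => exact rfl
  | cons A l ih =>
    exact ⟨hg.e, h A (by simp), hg.e, ih fun B hB => h B (by simp [hB]), by simp [hg.idl]⟩

theorem subset_listProd {l : List (Set H)} (h : ∀ A ∈ l, hg.e ∈ A) {A : Set H} (hA : A ∈ l) :
    A ⊆ hg.listProd l := by
  induction l with
  | nil => simp at hA
  | cons B l ih =>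
    intro x hx
    have hl : ∀ C ∈ l, hg.e ∈ C := fun C hC => h C (by simp [hC])
    rcases List.mem_cons.1 hA with rfl | hA
    · exact ⟨x, hx, hg.e, hg.e_mem_listProd hl, by simp [hg.idr]⟩
    · exact ⟨hg.e, h B (by simp), x, ih hl hA hx, by simp [hg.idl]⟩

theorem listProd_nonempty {l : List (Set H)} (h : ∀ A ∈ l, A.Nonempty) :
    (hg.listProd l).Nonempty := by
  induction l with
  | nil => exact ⟨hg.e, rfl⟩
  | cons A l ih =>
    obtain ⟨a, ha⟩ := h A (by simp)
    obtain ⟨b, hb⟩ := ih fun B hB => h B (by simp [hB])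
    obtain ⟨x, hx⟩ := hg.hmul_nonempty a b
    exact ⟨x, a, ha, b, hb, hx⟩

variable {hg}

theorem IsClosed.e_mem {C : Set H} (h : hg.IsClosed C) : hg.e ∈ C := by
  obtain ⟨x, hx⟩ := h.1
  exact h.2 ⟨_, ⟨x, hx, rfl⟩, x, hx, hg.mem_star_hmul_self x⟩

theorem IsClosed.star_mem {C : Set H} (h : hg.IsClosed C) {x : H} (hx : x ∈ C) :
    hg.star x ∈ C :=
  h.2 ⟨_, ⟨x, hx, rfl⟩, _, h.e_mem, by simp [hg.idr]⟩

theorem IsClosed.hmul_subset {C : Set H} (h : hg.IsClosed C) {x y : H} (hx : x ∈ C)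
    (hy : y ∈ C) : hg.hmul x y ⊆ C := fun _ hz =>
  h.2 ⟨x, ⟨_, h.star_mem hx, hg.star_star x⟩, y, hy, hz⟩

theorem IsClosed.listProd_subset {C : Set H} (h : hg.IsClosed C) {l : List (Set H)}
    (hl : ∀ A ∈ l, A ⊆ C) : hg.listProd l ⊆ C := by
  induction l with
  | nil => simpa [listProd] using h.e_mem
  | cons A l ih =>
    rintro x ⟨a, ha, b, hb, hx⟩
    exact h.hmul_subset (hl A (by simp) ha) (ih (fun B hB => hl B (by simp [hB])) hb) hx

variable (hg)

theorem isClosed_gen (A : Set H) : hg.IsClosed (hg.gen A) := by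
  refine ⟨⟨hg.e, fun C hC => hC.1.e_mem⟩, ?_⟩
  rintro x ⟨_, ⟨a, ha, rfl⟩, b, hb, hx⟩ C hC
  exact hC.1.2 ⟨_, ⟨a, ha C hC, rfl⟩, b, hb C hC, hx⟩

theorem subset_gen (A : Set H) : A ⊆ hg.gen A := fun _ hx _ hC => hC.2 hx

variable {hg}

theorem IsClosed.gen_subset {A C : Set H} (h : hg.IsClosed C) (hA : A ⊆ C) : hg.gen A ⊆ C :=
  fun _ hx => hx C ⟨h, hA⟩

theorem IsClosed.gen_eq {C : Set H} (h : hg.IsClosed C) : hg.gen C = C :=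
  (h.gen_subset subset_rfl).antisymm (hg.subset_gen C)

theorem IsInvolution.gen_eq {q : H} (h : hg.IsInvolution q) : hg.gen {q} = {hg.e, q} := by
  refine (h.2.gen_subset (by simp)).antisymm ?_
  rintro x (rfl | rfl)
  · exact (hg.isClosed_gen _).e_mem
  · exact hg.subset_gen _ rfl

theorem IsInvolution.star_eq {q : H} (h : hg.IsInvolution q) : hg.star q = q := by
  rcases h.2.star_mem (x := q) (by simp) with h' | h'
  · exact absurd (by rw [← hg.star_star q, h', hg.star_e]) h.1
  · exact h'

theorem isThin_e : hg.IsThin hg.e := by simp [IsThin, hg.star_e, hg.idl]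

end Hypergroup

namespace EA2Data

open Hypergroup

variable (E : EA2Data H)

theorem fam_eq (i : Fin E.n) : E.fam i = {E.hg.e, E.q i} := (E.invol i).gen_eq

theorem fam_inter_cofactor (i : Fin E.n) : E.fam i ∩ E.hg.cofactor E.fam i = {E.hg.e} :=
  E.dp.2.2 i

theorem isClosed_fam (i : Fin E.n) : E.hg.IsClosed (E.fam i) := E.hg.isClosed_gen _

theorem star_of_mem_fam {i : Fin E.n} {a : H} (ha : a ∈ E.fam i) : E.hg.star a = a := by
  rw [fam_eq] at ha
  rcases ha with rfl | rfl
  · exact E.hg.star_e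
  · exact (E.invol i).star_eq

theorem fam_subset_cofactor {i j : Fin E.n} (h : j ≠ i) :
    E.fam j ⊆ E.hg.cofactor E.fam i := by
  apply E.hg.subset_listProd
  · simp only [List.mem_map]
    rintro _ ⟨k, -, rfl⟩
    exact (E.isClosed_fam k).e_mem
  · exact List.mem_map.2 ⟨j, by simp [h], rfl⟩

theorem hmul_q_subset {i j : Fin E.n} (h : i ≠ j) :
    E.hg.hmul (E.q i) (E.q j) ⊆ E.hg.hmul (E.q j) (E.q i) := by
  intro x hx
  have hn := (E.dp.1 i).2.2.2 (E.q j) (Set.mem_univ _)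
  simp only [(E.invol i).gen_eq] at hn
  have hx' : x ∈ E.hg.smul {E.hg.e, E.q i} {E.q j} := ⟨E.q i, by simp, E.q j, rfl, hx⟩
  rw [hn] at hx'
  obtain ⟨_, rfl, c, hc, hx'⟩ := hx'
  rcases hc with rfl | rfl
  · rw [E.hg.idr] at hx'
    obtain rfl := Set.mem_singleton_iff.1 hx'
    have hq : E.q i ∈ E.fam j := by
      have := (E.hg.h3l _ _ _).1 hx
      have hj : E.q j ∈ E.fam j := by simp [fam_eq]
      exact (E.isClosed_fam j).hmul_subset hj ((E.isClosed_fam j).star_mem hj) this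
    have : E.q i ∈ E.fam i ∩ E.hg.cofactor E.fam i :=
      ⟨by simp [fam_eq], E.fam_subset_cofactor h.symm hq⟩
    rw [fam_inter_cofactor] at this
    exact absurd this (E.invol i).1
  · exact hx'

theorem hmul_comm_of_mem_fam {i j : Fin E.n} {a b : H} (ha : a ∈ E.fam i) (hb : b ∈ E.fam j) :
    E.hg.hmul a b = E.hg.hmul b a := by
  rw [fam_eq] at ha hb
  rcases ha with rfl | rfl
  · rw [E.hg.idl, E.hg.idr]
  rcases hb with rfl | rfl
  · rw [E.hg.idl, E.hg.idr]
  by_cases h : i = j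
  · rw [h]
  · exact (E.hmul_q_subset h).antisymm (E.hmul_q_subset (Ne.symm h))

theorem exists_isDecomp (x : H) : ∃ r, E.hg.IsDecomp E.fam x r := by
  have : x ∈ E.hg.dcover E.fam x := by
    rw [show E.hg.dcover E.fam x = {x} from E.constrained x]; rfl
  obtain ⟨r, hr, -⟩ := this
  exact ⟨r, hr⟩

variable {E} in
theorem famProd_eq {x : H} {r : Fin E.n → H} (h : E.hg.IsDecomp E.fam x r) :
    E.hg.famProd r = {x} := by
  refine Set.Subset.antisymm (fun y hy => ?_) (by simpa using h.2)
  have hc : E.hg.dcover E.fam x = {x} := E.constrained x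
  rw [← hc]
  exact ⟨r, h, hy⟩

theorem hmul_comm (x y : H) : E.hg.hmul x y = E.hg.hmul y x := by
  let := E.hg.setMonoid
  obtain ⟨r, hr⟩ := E.exists_isDecomp x
  obtain ⟨s, hs⟩ := E.exists_isDecomp y
  have key : Commute (E.hg.famProd r) (E.hg.famProd s) := by
    rw [famProd, famProd, listProd_eq_prod, listProd_eq_prod]
    refine Commute.list_prod_left _ _ fun A hA => Commute.list_prod_right _ _ fun B hB => ?_
    obtain ⟨i, -, rfl⟩ := List.mem_map.1 hA
    obtain ⟨j, -, rfl⟩ := List.mem_map.1 hB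
    change E.hg.smul _ _ = E.hg.smul _ _
    rw [smul_singleton, smul_singleton, E.hmul_comm_of_mem_fam (hr.1 i) (hs.1 j)]
  rw [famProd_eq hr, famProd_eq hs] at key
  rw [← smul_singleton, ← smul_singleton]
  exact key

/-- The commutative monoid of subsets of an elementary abelian 2-hypergroup. -/
@[reducible] def setCommMonoid : CommMonoid (Set H) where
  __ := E.hg.setMonoid
  mul_comm A B := by
    ext x
    change (∃ b ∈ A, ∃ c ∈ B, x ∈ E.hg.hmul b c) ↔ ∃ b ∈ B, ∃ c ∈ A, x ∈ E.hg.hmul b c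
    constructor <;> rintro ⟨b, hb, c, hc, h⟩ <;> exact ⟨c, hc, b, hb, E.hmul_comm b c ▸ h⟩

theorem famProd_eq_prod (r : Fin E.n → H) :
    E.hg.famProd r = (letI := E.setCommMonoid; ∏ i, ({r i} : Set H)) := by
  let := E.setCommMonoid
  rw [famProd, listProd_eq_prod, Fin.prod_univ_def]

theorem cofactor_eq_prod (i : Fin E.n) :
    E.hg.cofactor E.fam i =
      (letI := E.setCommMonoid; ∏ j ∈ Finset.univ.erase i, E.fam j) := by
  let := E.setCommMonoid
  rw [cofactor, listProd_eq_prod,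
    ← List.prod_toFinset _ ((List.nodup_finRange _).filter _)]
  congr 1
  ext j
  simp

theorem prod_subset_prod {s : Finset (Fin E.n)} {A B : Fin E.n → Set H}
    (h : ∀ i ∈ s, A i ⊆ B i) :
    (letI := E.setCommMonoid; ∏ i ∈ s, A i ⊆ ∏ i ∈ s, B i) := by
  let := E.setCommMonoid
  change ∏ i ∈ s, A i ⊆ ∏ i ∈ s, B i
  induction s using Finset.induction_on with
  | empty => simp
  | insert i s hi ih =>
    rw [Finset.prod_insert hi, Finset.prod_insert hi]
    exact E.hg.smul_mono (h i (by simp)) (ih fun j hj => h j (by simp [hj]))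

theorem mem_prod_iff {s : Finset (Fin E.n)} {A : Fin E.n → Set H} {x : H}
    (hA : ∀ i, (A i).Nonempty) :
    (letI := E.setCommMonoid; x ∈ ∏ i ∈ s, A i ↔
      ∃ t : Fin E.n → H, (∀ i, t i ∈ A i) ∧ x ∈ ∏ i ∈ s, ({t i} : Set H)) := by
  let := E.setCommMonoid
  change x ∈ ∏ i ∈ s, A i ↔
      ∃ t : Fin E.n → H, (∀ i, t i ∈ A i) ∧ x ∈ ∏ i ∈ s, ({t i} : Set H)
  constructor
  · induction s using Finset.induction_on generalizing x with
    | empty =>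
      choose t ht using hA
      exact fun hx => ⟨t, ht, hx⟩
    | insert i s hi ih =>
      rw [Finset.prod_insert hi]
      rintro ⟨a, ha, b, hb, hx⟩
      obtain ⟨t, ht, hb⟩ := ih hb
      refine ⟨Function.update t i a, fun j => ?_, ?_⟩
      · by_cases h : j = i
        · subst h; simpa using ha
        · simpa [h] using ht j
      · rw [Finset.prod_insert hi]
        refine ⟨a, by simp, b, ?_, hx⟩
        rwa [Finset.prod_congr rfl fun j hj => by
          rw [Function.update_of_ne (ne_of_mem_of_not_mem hj hi)]]
  · rintro ⟨t, ht, hx⟩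
    exact E.prod_subset_prod (fun i _ => by simpa using ht i) hx

theorem hmul_eq_prod {x y : H} {r s : Fin E.n → H} (hr : E.hg.IsDecomp E.fam x r)
    (hs : E.hg.IsDecomp E.fam y s) :
    E.hg.hmul x y = (letI := E.setCommMonoid; ∏ i, E.hg.hmul (r i) (s i)) := by
  let := E.setCommMonoid
  have h : E.hg.hmul x y = E.hg.famProd r * E.hg.famProd s := by
    rw [famProd_eq hr, famProd_eq hs, ← smul_singleton]; rfl
  rw [h, famProd_eq_prod, famProd_eq_prod, ← Finset.prod_mul_distrib]
  exact Finset.prod_congr rfl fun i _ => E.hg.smul_singleton _ _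

theorem e_mem_prod {s : Finset (Fin E.n)} {A : Fin E.n → Set H} (h : ∀ i ∈ s, E.hg.e ∈ A i) :
    (letI := E.setCommMonoid; E.hg.e ∈ ∏ i ∈ s, A i) := by
  let := E.setCommMonoid
  have := E.prod_subset_prod (A := fun _ => 1) (B := A) (s := s)
    fun i hi => Set.singleton_subset_iff.2 (h i hi)
  rw [Finset.prod_const_one] at this
  exact this rfl

theorem star_eq (x : H) : E.hg.star x = x := by
  obtain ⟨r, hr⟩ := E.exists_isDecomp x
  refine (E.hg.eq_star_of_e_mem ?_).symm
  rw [E.hmul_eq_prod hr hr]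
  refine E.e_mem_prod fun i _ => ?_
  have := E.hg.mem_star_hmul_self (r i)
  rwa [E.star_of_mem_fam (hr.1 i)] at this

variable {E} in
theorem isClosed_iff {C : Set H} :
    E.hg.IsClosed C ↔ C.Nonempty ∧ ∀ x ∈ C, ∀ y ∈ C, E.hg.hmul x y ⊆ C := by
  refine ⟨fun h => ⟨h.1, fun x hx y hy => h.hmul_subset hx hy⟩, fun h => ⟨h.1, ?_⟩⟩
  rintro z ⟨_, ⟨x, hx, rfl⟩, y, hy, hz⟩
  rw [E.star_eq] at hz
  exact h.2 x hx y hy hz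

variable {E} in
theorem isClosed_smul {C D : Set H} (hC : E.hg.IsClosed C) (hD : E.hg.IsClosed D) :
    E.hg.IsClosed (E.hg.smul C D) := by
  let := E.setCommMonoid
  refine isClosed_iff.2
    ⟨⟨E.hg.e, E.hg.e, hC.e_mem, E.hg.e, hD.e_mem, by simp [E.hg.idl]⟩, fun x hx y hy z hz => ?_⟩
  have h : z ∈ (C * D) * (C * D) := ⟨x, hx, y, hy, hz⟩
  rw [mul_mul_mul_comm] at h
  refine E.hg.smul_mono ?_ ?_ h
  · rintro w ⟨a, ha, b, hb, hw⟩
    exact hC.hmul_subset ha hb hw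
  · rintro w ⟨a, ha, b, hb, hw⟩
    exact hD.hmul_subset ha hb hw

theorem cofactor_hmul_subset {i : Fin E.n} {a b : H} (ha : a ∈ E.hg.cofactor E.fam i)
    (hb : b ∈ E.hg.cofactor E.fam i) : E.hg.hmul a b ⊆ E.hg.cofactor E.fam i := by
  let := E.setCommMonoid
  rw [cofactor_eq_prod] at *
  intro x hx
  have h : x ∈ (∏ j ∈ Finset.univ.erase i, E.fam j) * ∏ j ∈ Finset.univ.erase i, E.fam j :=
    ⟨a, ha, b, hb, hx⟩
  rw [← Finset.prod_mul_distrib] at h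
  refine E.prod_subset_prod (fun j _ => ?_) h
  rintro w ⟨a, ha, b, hb, hw⟩
  exact (E.isClosed_fam j).hmul_subset ha hb hw

variable {E} in
theorem exists_mem_cofactor_of_isDecomp {x : H} {r : Fin E.n → H}
    (h : E.hg.IsDecomp E.fam x r) (i : Fin E.n) :
    ∃ c ∈ E.hg.cofactor E.fam i, x ∈ E.hg.hmul (r i) c := by
  let := E.setCommMonoid
  have hx := h.2
  rw [famProd_eq_prod, ← Finset.mul_prod_erase _ _ (Finset.mem_univ i)] at hx
  obtain ⟨_, rfl, c, hc, hx⟩ := hx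
  refine ⟨c, ?_, hx⟩
  rw [cofactor_eq_prod]
  exact E.prod_subset_prod (fun j _ => Set.singleton_subset_iff.2 (h.1 j)) hc

variable {E} in
theorem isDecomp_unique {x : H} {r s : Fin E.n → H} (hr : E.hg.IsDecomp E.fam x r)
    (hs : E.hg.IsDecomp E.fam x s) : r = s := by
  funext i
  obtain ⟨c, hc, hxc⟩ := exists_mem_cofactor_of_isDecomp hr i
  obtain ⟨d, hd, hxd⟩ := exists_mem_cofactor_of_isDecomp hs i
  rw [E.hg.h3l, E.star_eq] at hxc
  have h : r i ∈ E.hg.smul (E.hg.smul {s i} {d}) {c} :=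
    ⟨x, by rwa [smul_singleton], c, rfl, hxc⟩
  rw [Hypergroup.smul_assoc, smul_singleton] at h
  obtain ⟨_, rfl, k, hk, h⟩ := h
  have hki : k ∈ E.fam i :=
    (E.isClosed_fam i).hmul_subset ((E.isClosed_fam i).star_mem (hs.1 i)) (hr.1 i)
      ((E.hg.h3r _ _ _).1 h)
  have hke : k ∈ E.fam i ∩ E.hg.cofactor E.fam i := ⟨hki, E.cofactor_hmul_subset hd hc hk⟩
  rw [fam_inter_cofactor] at hke
  rw [Set.mem_singleton_iff.1 hke, E.hg.idr] at h
  exact h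

/-- The coordinates of an element with respect to the direct decomposition. -/
noncomputable def coord (x : H) : Fin E.n → H := (E.exists_isDecomp x).choose

theorem isDecomp_coord (x : H) : E.hg.IsDecomp E.fam x (E.coord x) :=
  (E.exists_isDecomp x).choose_spec

theorem coord_mem (x : H) (i : Fin E.n) : E.coord x i ∈ E.fam i := (E.isDecomp_coord x).1 i

theorem coord_eq_or (x : H) (i : Fin E.n) : E.coord x i = E.hg.e ∨ E.coord x i = E.q i := by
  simpa [fam_eq] using E.coord_mem x i

variable {E} in
theorem coord_eq {x : H} {r : Fin E.n → H} (h : E.hg.IsDecomp E.fam x r) : E.coord x = r :=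
  isDecomp_unique (E.isDecomp_coord x) h

theorem coord_injective : Function.Injective E.coord := fun x y h => by
  have hx := famProd_eq (E.isDecomp_coord x)
  rw [h, famProd_eq (E.isDecomp_coord y)] at hx
  exact (Set.singleton_injective hx).symm

theorem exists_coord_eq {r : Fin E.n → H} (hr : ∀ i, r i ∈ E.fam i) : ∃ x, E.coord x = r := by
  obtain ⟨x, hx⟩ : (E.hg.famProd r).Nonempty := by
    refine E.hg.listProd_nonempty fun A hA => ?_
    obtain ⟨i, -, rfl⟩ := List.mem_map.1 hA
    exact Set.singleton_nonempty _
  exact ⟨x, coord_eq ⟨hr, hx⟩⟩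

theorem mem_hmul_iff {x y z : H} :
    z ∈ E.hg.hmul x y ↔ ∀ i, E.coord z i ∈ E.hg.hmul (E.coord x i) (E.coord y i) := by
  rw [E.hmul_eq_prod (E.isDecomp_coord x) (E.isDecomp_coord y),
    mem_prod_iff _ fun i => E.hg.hmul_nonempty _ _]
  constructor
  · rintro ⟨t, ht, hz⟩
    rw [← famProd_eq_prod] at hz
    rwa [coord_eq ⟨fun i => (E.isClosed_fam i).hmul_subset (E.coord_mem x i) (E.coord_mem y i)
      (ht i), hz⟩]
  · intro h
    refine ⟨_, h, ?_⟩
    rw [← famProd_eq_prod]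
    exact (E.isDecomp_coord z).2

variable {E} in
theorem coord_of_mem_fam {i : Fin E.n} {a : H} (ha : a ∈ E.fam i) :
    E.coord a = Function.update (fun _ => E.hg.e) i a := by
  let := E.setCommMonoid
  refine coord_eq ⟨fun j => ?_, ?_⟩
  · by_cases h : j = i
    · subst h; simpa using ha
    · simpa [h] using (E.isClosed_fam j).e_mem
  · rw [famProd_eq_prod, Finset.prod_eq_single i]
    · simp
    · intro j _ h
      rw [Function.update_of_ne h]
      rfl
    · simp

theorem coord_e (i : Fin E.n) : E.coord E.hg.e i = E.hg.e := by
  rw [coord_of_mem_fam (E.isClosed_fam i).e_mem]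
  simp

theorem eq_e_iff {x : H} : x = E.hg.e ↔ ∀ i, E.coord x i = E.hg.e := by
  refine ⟨fun h i => by rw [h, coord_e], fun h => E.coord_injective ?_⟩
  funext i
  rw [h, coord_e]

theorem mem_of_coord_mem {C : Set H} (hC : E.hg.IsClosed C) {x : H}
    (h : ∀ i, E.coord x i ∈ C) : x ∈ C := by
  refine hC.listProd_subset (fun A hA => ?_) (E.isDecomp_coord x).2
  obtain ⟨i, -, rfl⟩ := List.mem_map.1 hA
  exact Set.singleton_subset_iff.2 (h i)

theorem e_mem_hmul_self (x : H) : E.hg.e ∈ E.hg.hmul x x := by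
  simpa [E.star_eq] using E.hg.mem_star_hmul_self x

variable {E} in
theorem hmul_self_of_isThin {a : H} (h : E.hg.IsThin a) : E.hg.hmul a a = {E.hg.e} := by
  simpa [IsThin, E.star_eq] using h

theorem hmul_coord_self_of_isThick {x : H} {i : Fin E.n} (h : E.hg.IsThick (E.coord x i)) :
    E.hg.hmul (E.coord x i) (E.coord x i) = {E.hg.e, E.coord x i} := by
  have hsub := (E.isClosed_fam i).hmul_subset (E.coord_mem x i) (E.coord_mem x i)
  have hq : E.coord x i = E.q i :=
    (E.coord_eq_or x i).resolve_left fun h' => h (h' ▸ isThin_e)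
  rw [fam_eq, ← hq] at hsub
  refine hsub.antisymm ?_
  rintro a (rfl | rfl)
  · exact E.e_mem_hmul_self _
  · by_contra hn
    apply h
    rw [IsThin, E.star_eq]
    refine Set.Subset.antisymm (fun a ha => ?_) (by simpa using E.e_mem_hmul_self _)
    rcases hsub ha with h' | h'
    · exact h'
    · exact absurd (h' ▸ ha) hn

theorem coord_mem_hmul_self {x : H} {i : Fin E.n} (h : E.hg.IsThick (E.coord x i)) :
    E.coord x i ∈ E.hg.hmul x x := by
  rw [mem_hmul_iff]
  intro j
  rw [coord_of_mem_fam (E.coord_mem x i)]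
  by_cases hj : j = i
  · subst hj
    simp [E.hmul_coord_self_of_isThick h]
  · simpa [hj] using E.e_mem_hmul_self _

theorem isThin_iff {x : H} : E.hg.IsThin x ↔ ∀ i, E.hg.IsThin (E.coord x i) := by
  constructor
  · intro h i
    by_contra hi
    have := E.coord_mem_hmul_self hi
    rw [hmul_self_of_isThin h] at this
    exact hi (by rw [Set.mem_singleton_iff.1 this]; exact isThin_e)
  · intro h
    rw [IsThin, E.star_eq]
    ext z
    rw [mem_hmul_iff, Set.mem_singleton_iff, eq_e_iff]
    exact forall_congr' fun i => by rw [hmul_self_of_isThin (h i), Set.mem_singleton_iff]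

theorem isClosed_Othin {G : Set H} (hG : E.hg.IsClosed G) : E.hg.IsClosed (E.hg.Othin G) := by
  refine isClosed_iff.2 ⟨⟨E.hg.e, hG.e_mem, isThin_e⟩, ?_⟩
  rintro x ⟨hx, hxt⟩ y ⟨hy, hyt⟩ z hz
  refine ⟨hG.hmul_subset hx hy hz, E.isThin_iff.2 fun i => ?_⟩
  have hzi := E.mem_hmul_iff.1 hz i
  have hxi := E.isThin_iff.1 hxt i
  have hyi := E.isThin_iff.1 hyt i
  rcases E.coord_eq_or x i with h | h
  · rw [h, E.hg.idl] at hzi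
    rwa [Set.mem_singleton_iff.1 hzi]
  rcases E.coord_eq_or y i with h' | h'
  · rw [h', E.hg.idr] at hzi
    rwa [Set.mem_singleton_iff.1 hzi]
  rw [h', ← h, hmul_self_of_isThin hxi] at hzi
  rw [Set.mem_singleton_iff.1 hzi]
  exact isThin_e

section Thick

variable {E} {r : H}

theorem mem_ThickIn
    (hr : ∀ i, E.coord r i = E.hg.e ∨ E.hg.IsThick (E.coord r i)) :
    r ∈ E.ThickIn Set.univ := by
  refine ⟨Set.mem_univ _, Or.inr ?_⟩
  rintro _ ⟨hy, s, hs, i, rfl⟩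
  rw [← coord_eq hs] at hy ⊢
  exact (hr i).resolve_left hy

theorem mem_hmul_self_iff
    (hr : ∀ i, E.coord r i = E.hg.e ∨ E.hg.IsThick (E.coord r i)) {z : H} :
    z ∈ E.hg.hmul r r ↔ ∀ i, E.coord z i = E.hg.e ∨ E.coord z i = E.coord r i := by
  rw [mem_hmul_iff]
  refine forall_congr' fun i => ?_
  rcases hr i with h | h
  · simp [h, E.hg.idl]
  · simp [E.hmul_coord_self_of_isThick h]

theorem isClosed_hmul_self
    (hr : ∀ i, E.coord r i = E.hg.e ∨ E.hg.IsThick (E.coord r i)) :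
    E.hg.IsClosed (E.hg.hmul r r) := by
  refine isClosed_iff.2 ⟨⟨_, E.e_mem_hmul_self r⟩, fun x hx y hy z hz => ?_⟩
  rw [mem_hmul_self_iff hr] at *
  intro i
  have hzi := E.mem_hmul_iff.1 hz i
  rcases hx i with h | h
  · rw [h, E.hg.idl] at hzi
    rw [Set.mem_singleton_iff.1 hzi]
    exact hy i
  rcases hy i with h' | h'
  · rw [h', E.hg.idr] at hzi
    rw [Set.mem_singleton_iff.1 hzi]
    exact hx i
  rw [h, h'] at hzi
  rcases hr i with h | h
  · exact Or.inl (by simpa [h, E.hg.idl] using hzi)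
  · simpa [E.hmul_coord_self_of_isThick h] using hzi

theorem gen_singleton_eq
    (hr : ∀ i, E.coord r i = E.hg.e ∨ E.hg.IsThick (E.coord r i)) :
    E.hg.gen {r} = E.hg.hmul r r := by
  refine ((isClosed_hmul_self hr).gen_subset ?_).antisymm ?_
  · exact Set.singleton_subset_iff.2 ((mem_hmul_self_iff hr).2 fun i => Or.inr rfl)
  · have h := E.hg.subset_gen {r} rfl
    exact (E.hg.isClosed_gen _).hmul_subset h h

theorem Osup_eq
    (hr : ∀ i, E.coord r i = E.hg.e ∨ E.hg.IsThick (E.coord r i))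
    {G : Set H} (hG : E.hg.IsClosed G) (hrG : r ∈ G)
    (hmax : ∀ x ∈ G, ∀ i, E.hg.IsThick (E.coord x i) → E.coord r i = E.coord x i) :
    E.hg.Osup G = E.hg.hmul r r := by
  rw [Osup, hG.gen_eq]
  apply Set.Subset.antisymm
  · refine Set.sInter_subset_of_mem ⟨isClosed_hmul_self hr, hG, hG.hmul_subset hrG hrG, ?_⟩
    rintro p hp z ⟨a, ⟨p', hp', c, hc, ha⟩, p'', hp'', hz⟩
    rw [Set.mem_singleton_iff.1 hp', E.star_eq, E.hmul_comm] at ha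
    rw [Set.mem_singleton_iff.1 hp''] at hz
    have hz' : z ∈ E.hg.smul (E.hg.smul {c} {p}) {p} :=
      ⟨a, by rwa [smul_singleton], p, rfl, hz⟩
    rw [Hypergroup.smul_assoc, smul_singleton] at hz'
    obtain ⟨_, rfl, d, hd, hz'⟩ := hz'
    refine (isClosed_hmul_self hr).hmul_subset hc ?_ hz'
    rw [mem_hmul_self_iff hr]
    intro i
    have hdi := E.mem_hmul_iff.1 hd i
    by_cases ht : E.hg.IsThin (E.coord p i)
    · rw [hmul_self_of_isThin ht] at hdi
      exact Or.inl hdi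
    · rw [E.hmul_coord_self_of_isThick ht, ← hmax p hp i ht] at hdi
      exact hdi
  · rintro z hz F hF
    refine hF.2.2.2 r hrG ⟨r, ⟨_, rfl, E.hg.e, hF.1.e_mem, ?_⟩, r, rfl, hz⟩
    simp [E.star_eq, E.hg.idr]

end Thick

theorem exists_max_thick {G : Set H} (hG : E.hg.IsClosed G) :
    ∃ r ∈ G, (∀ i, E.coord r i = E.hg.e ∨ E.hg.IsThick (E.coord r i)) ∧
      ∀ x ∈ G, ∀ i, E.hg.IsThick (E.coord x i) → E.coord r i = E.coord x i := by
  classical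
  obtain ⟨r, hr⟩ := E.exists_coord_eq
    (r := fun i => if ∃ x ∈ G, E.hg.IsThick (E.coord x i) then E.q i else E.hg.e) fun i => by
      rw [fam_eq]; split_ifs <;> simp
  have hq : ∀ x i, E.hg.IsThick (E.coord x i) → E.coord x i = E.q i := fun x i h =>
    (E.coord_eq_or x i).resolve_left fun h' => h (h' ▸ isThin_e)
  refine ⟨r, E.mem_of_coord_mem hG fun i => ?_, fun i => ?_, fun x hx i hi => ?_⟩
  · rw [hr]
    dsimp only
    split_ifs with h
    · obtain ⟨x, hx, hi⟩ := h
      rw [← hq x i hi]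
      exact hG.hmul_subset hx hx (E.coord_mem_hmul_self hi)
    · exact hG.e_mem
  · rw [hr]
    dsimp only
    split_ifs with h
    · obtain ⟨x, hx, hi⟩ := h
      rw [← hq x i hi]
      exact Or.inr hi
    · exact Or.inl rfl
  · rw [hr, hq x i hi]
    exact if_pos ⟨x, hx, hi⟩

theorem exists_thick_thin_factors (x : H) :
    ∃ a b, x ∈ E.hg.hmul a b ∧ b ∈ E.hg.hmul a x ∧ E.hg.IsThin b ∧
      ∀ i, E.coord a i = E.hg.e ∨
        (E.hg.IsThick (E.coord x i) ∧ E.coord a i = E.coord x i) := by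
  classical
  obtain ⟨a, ha⟩ := E.exists_coord_eq
    (r := fun i => if E.hg.IsThick (E.coord x i) then E.coord x i else E.hg.e) fun i => by
      split_ifs
      · exact E.coord_mem x i
      · exact (E.isClosed_fam i).e_mem
  obtain ⟨b, hb⟩ := E.exists_coord_eq
    (r := fun i => if E.hg.IsThick (E.coord x i) then E.hg.e else E.coord x i) fun i => by
      split_ifs
      · exact (E.isClosed_fam i).e_mem
      · exact E.coord_mem x i
  refine ⟨a, b, E.mem_hmul_iff.2 fun i => ?_, E.mem_hmul_iff.2 fun i => ?_,
    E.isThin_iff.2 fun i => ?_, fun i => ?_⟩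
  · rw [ha, hb]
    dsimp only
    split_ifs <;> simp [E.hg.idl, E.hg.idr]
  · rw [ha, hb]
    dsimp only
    split_ifs with h
    · exact E.e_mem_hmul_self _
    · simp [E.hg.idl]
  · rw [hb]
    dsimp only
    split_ifs with h
    · exact isThin_e
    · exact not_not.1 h
  · rw [ha]
    dsimp only
    split_ifs with h
    · exact Or.inr ⟨h, rfl⟩
    · exact Or.inl rfl

end EA2Data

end HyperPaper

/-- In an elementary abelian 2-hypergroup, G ⊆ H is a closed subset iff
there exist r ∈ Thick(H) and F ⊆ H with O^ϑ(G) = ⟨r⟩, F^γ a subgroup of the elementary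
abelian 2-group O_ϑ(H)^γ (i.e. F is a closed subset contained in O_ϑ(H)),
G = ⟨r⟩·F, ⟨r⟩ ∩ F = {e}, and O_ϑ(G) = F. -/
theorem stmt8 {H : Type*} (E : EA2Data H) (G : Set H) :
    E.hg.IsClosed G ↔
      ∃ r ∈ E.ThickIn Set.univ, ∃ F : Set H,
        E.hg.Osup G = E.hg.gen {r} ∧
        (E.hg.IsClosed F ∧ F ⊆ E.hg.Othin Set.univ) ∧
        G = E.hg.smul (E.hg.gen {r}) F ∧
        E.hg.gen {r} ∩ F = {E.hg.e} ∧
        E.hg.Othin G = F := by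
  constructor
  · intro hG
    obtain ⟨r, hrG, hr, hmax⟩ := E.exists_max_thick hG
    have hCG : E.hg.hmul r r ⊆ G := hG.hmul_subset hrG hrG
    refine ⟨r, EA2Data.mem_ThickIn hr, E.hg.Othin G, ?_⟩
    rw [EA2Data.gen_singleton_eq hr]
    refine ⟨EA2Data.Osup_eq hr hG hrG hmax,
      ⟨E.isClosed_Othin hG, fun x hx => ⟨Set.mem_univ x, hx.2⟩⟩, ?_, ?_, rfl⟩
    · apply Set.Subset.antisymm
      · intro x hx
        obtain ⟨a, b, hxab, hb, hbt, ha⟩ := E.exists_thick_thin_factors x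
        have haC : a ∈ E.hg.hmul r r := (EA2Data.mem_hmul_self_iff hr).2 fun i =>
          (ha i).imp_right fun h => h.2.trans (hmax x hx i h.1).symm
        exact ⟨a, haC, b, ⟨hG.hmul_subset (hCG haC) hx hb, hbt⟩, hxab⟩
      · rintro x ⟨a, ha, b, hb, hx⟩
        exact hG.hmul_subset (hCG ha) hb.1 hx
    · apply Set.Subset.antisymm
      · rintro z ⟨hz, -, hzt⟩
        refine E.eq_e_iff.2 fun i => ?_
        rcases (EA2Data.mem_hmul_self_iff hr).1 hz i with h | h
        · exact h
        · exact h.trans ((hr i).resolve_right fun h' => h' (h ▸ E.isThin_iff.1 hzt i))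
      · rintro z rfl
        exact ⟨E.e_mem_hmul_self r, hG.e_mem, Hypergroup.isThin_e⟩
  · rintro ⟨r, -, F, -, ⟨hF, -⟩, rfl, -, -⟩
    exact EA2Data.isClosed_smul (E.hg.isClosed_gen _) hF
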